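/- Fix r > 0 and ε ∈ (−1,0). On the open simplex Δ = {(z₁,z₂,z₃) ∈ (0,∞)³ : z₁+z₂+z₃ < 1}, with z₄ := 1−z₁−z₂−z₃ and F := r·z₁z₃ + z₂z₄ > 0, the functions z₁²z₃²·F^{−(4+ε)}, z₁z₃·F^{−(3+ε)} and z₁z₂z₃z₄·F^{−(4+ε)} are Lebesgue integrable on Δ, and r·∫_Δ z₁²z₃² F^{−(4+ε)} = ∫_Δ z₁z₃ F^{−(3+ε)} − ∫_Δ z₁z₂z₃z₄ F^{−(4+ε)}. -/

import Mathlib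

open MeasureTheory

noncomputable section

/-- The open simplex `Δ = {(z₁,z₂,z₃) ∈ (0,∞)³ : z₁+z₂+z₃ < 1}`. -/
def boxDelta : Set (ℝ × ℝ × ℝ) :=
  {z | 0 < z.1 ∧ 0 < z.2.1 ∧ 0 < z.2.2 ∧ z.1 + z.2.1 + z.2.2 < 1}

/-- The fourth Feynman parameter `z₄ = 1 − z₁ − z₂ − z₃`. -/
def boxZ4 (z : ℝ × ℝ × ℝ) : ℝ := 1 - z.1 - z.2.1 - z.2.2

/-- The second Symanzik polynomial of the massless box, `F = r z₁ z₃ + z₂ z₄`. -/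
def boxF (r : ℝ) (z : ℝ × ℝ × ℝ) : ℝ := r * z.1 * z.2.2 + z.2.1 * boxZ4 z

end

/-- The power `x ^ (-s)` cut off to the unit interval. -/
noncomputable def unitPow (s : ℝ) : ℝ → ℝ :=
  (Set.Ioo (0 : ℝ) 1).indicator fun x => x ^ (-s)

lemma unitPow_of_mem {s x : ℝ} (h₀ : 0 < x) (h₁ : x < 1) : unitPow s x = x ^ (-s) :=
  Set.indicator_of_mem (Set.mem_Ioo.2 ⟨h₀, h₁⟩) _

lemma integrable_unitPow {s : ℝ} (hs : s < 1) : Integrable (unitPow s) := by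
  rw [unitPow, integrable_indicator_iff measurableSet_Ioo,
    ← intervalIntegrable_iff_integrableOn_Ioo_of_le zero_le_one]
  exact intervalIntegral.intervalIntegrable_rpow' (by linarith)

/-- The product of cut-off powers in three variables. -/
noncomputable def unitPow₃ (s : ℝ) (z : ℝ × ℝ × ℝ) : ℝ :=
  unitPow s z.1 * (unitPow s z.2.1 * unitPow s z.2.2)

lemma integrable_unitPow₃ {s : ℝ} (hs : s < 1) : Integrable (unitPow₃ s) :=
  (integrable_unitPow hs).mul_prod ((integrable_unitPow hs).mul_prod (integrable_unitPow hs))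

lemma measurePreserving_rotate :
    MeasurePreserving fun z : ℝ × ℝ × ℝ => (z.2.1, z.2.2, z.1) :=
  (measurePreserving_prodAssoc (volume : Measure ℝ) (volume : Measure ℝ)
    (volume : Measure ℝ)).comp
    (Measure.measurePreserving_swap (μ := (volume : Measure ℝ))
      (ν := (volume : Measure (ℝ × ℝ))))

lemma measurePreserving_exchange_boxZ4 :
    MeasurePreserving fun z : ℝ × ℝ × ℝ => (z.1, z.2.1, boxZ4 z) := by
  have inner (a : ℝ) : MeasurePreserving fun y : ℝ × ℝ => (y.1, 1 - a - y.1 - y.2) :=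
    (MeasurePreserving.id volume).skew_product (g := fun b c : ℝ => 1 - a - b - c)
      (by unfold Function.uncurry; fun_prop)
      (.of_forall fun b => (Measure.measurePreserving_sub_left volume (1 - a - b)).map_eq)
  exact (MeasurePreserving.id volume).skew_product
    (g := fun (a : ℝ) (y : ℝ × ℝ) => (y.1, 1 - a - y.1 - y.2))
    (by unfold Function.uncurry; fun_prop) (.of_forall fun a => (inner a).map_eq)

lemma measurableSet_boxDelta : MeasurableSet boxDelta := by
  unfold boxDelta
  measurability

@[fun_prop]
lemma measurable_boxZ4 : Measurable boxZ4 := by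
  unfold boxZ4
  fun_prop

@[fun_prop]
lemma measurable_boxF (r : ℝ) : Measurable (boxF r) := by
  unfold boxF
  fun_prop

lemma boxZ4_pos {z : ℝ × ℝ × ℝ} (hz : z ∈ boxDelta) : 0 < boxZ4 z := by
  have := hz.2.2.2
  unfold boxZ4
  linarith

lemma mul_four_le_of_exists_le {K a b c d : ℝ} (ha : 0 ≤ a) (hb : 0 ≤ b) (hc : 0 ≤ c)
    (hd : 0 ≤ d) (hK : 0 ≤ K) (h : a ≤ K ∨ b ≤ K ∨ c ≤ K ∨ d ≤ K) :
    a * b * c * d ≤ K * (a * (b * c) + a * (b * d) + b * (c * d) + c * (a * d)) := by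
  have h₁ : 0 ≤ K * (a * (b * c)) := by positivity
  have h₂ : 0 ≤ K * (a * (b * d)) := by positivity
  have h₃ : 0 ≤ K * (b * (c * d)) := by positivity
  have h₄ : 0 ≤ K * (c * (a * d)) := by positivity
  rcases h with h | h | h | h
  · nlinarith [mul_le_mul_of_nonneg_right h (by positivity : 0 ≤ b * (c * d))]
  · nlinarith [mul_le_mul_of_nonneg_right h (by positivity : 0 ≤ c * (a * d))]
  · nlinarith [mul_le_mul_of_nonneg_right h (by positivity : 0 ≤ a * (b * d))]
  · nlinarith [mul_le_mul_of_nonneg_right h (by positivity : 0 ≤ a * (b * c))]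

/-- Convergence of the symmetric Dirichlet integral over the simplex. -/
lemma integrableOn_dirichlet {s : ℝ} (hs₀ : 0 ≤ s) (hs : s < 1) :
    IntegrableOn (fun z => (z.1 * z.2.1 * z.2.2 * boxZ4 z) ^ (-s)) boxDelta := by
  have hG := integrable_unitPow₃ hs
  have hG₃ := measurePreserving_exchange_boxZ4.integrable_comp_of_integrable hG
  have hG₁ := measurePreserving_rotate.integrable_comp_of_integrable hG₃
  have hG₂ := measurePreserving_rotate.integrable_comp_of_integrable hG₁
  refine Integrable.mono' ((((hG.add hG₃).add hG₁).add hG₂).const_mul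
    ((1 / 4 : ℝ) ^ (-s))).integrableOn
    (Measurable.pow_const (by fun_prop) _).aestronglyMeasurable ?_
  filter_upwards [ae_restrict_mem measurableSet_boxDelta] with z hz
  have h₄ := boxZ4_pos hz
  obtain ⟨a, b, c⟩ := z
  obtain ⟨h₁, h₂, h₃, -⟩ := hz
  have e₁ : boxZ4 (b, c, a) = boxZ4 (a, b, c) := by simp only [boxZ4]; ring
  have e₂ : boxZ4 (c, a, b) = boxZ4 (a, b, c) := by simp only [boxZ4]; ring
  have hd : boxZ4 (a, b, c) = 1 - a - b - c := rfl
  simp only [Pi.add_apply, Function.comp_apply, unitPow₃, e₁, e₂]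
  dsimp only at h₁ h₂ h₃
  generalize boxZ4 (a, b, c) = d at *
  rw [unitPow_of_mem h₁ (by linarith), unitPow_of_mem h₂ (by linarith),
    unitPow_of_mem h₃ (by linarith), unitPow_of_mem h₄ (by linarith),
    Real.norm_of_nonneg (by positivity), Real.mul_rpow (by positivity) h₄.le,
    Real.mul_rpow (by positivity) h₃.le, Real.mul_rpow h₁.le h₂.le]
  refine mul_four_le_of_exists_le (by positivity) (by positivity) (by positivity)
    (by positivity) (by positivity) ?_
  have key {x : ℝ} (hx : 1 / 4 ≤ x) : x ^ (-s) ≤ (1 / 4 : ℝ) ^ (-s) :=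
    Real.rpow_le_rpow_of_nonpos (by norm_num) hx (by linarith)
  by_contra! h
  have key' {x : ℝ} (hx : (1 / 4 : ℝ) ^ (-s) < x ^ (-s)) : x < 1 / 4 :=
    lt_of_not_ge fun h => (key h).not_gt hx
  linarith [key' h.1, key' h.2.1, key' h.2.2.1, key' h.2.2.2]

lemma boxF_pos {r : ℝ} (hr : 0 < r) {z : ℝ × ℝ × ℝ} (hz : z ∈ boxDelta) : 0 < boxF r z :=
  add_pos (mul_pos (mul_pos hr hz.1) hz.2.2.1) (mul_pos hz.2.1 (boxZ4_pos hz))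

lemma mul_rpow_boxF_le {r p : ℝ} (hr : 0 < r) (hp : 0 ≤ p) {z : ℝ × ℝ × ℝ}
    (hz : z ∈ boxDelta) :
    z.1 * z.2.2 * boxF r z ^ (-(1 + 2 * p)) ≤
      r⁻¹ * r ^ (-p) * (z.1 * z.2.1 * z.2.2 * boxZ4 z) ^ (-p) := by
  have hF := boxF_pos hr hz
  have h₄ := boxZ4_pos hz
  have hF' : boxF r z = r * z.1 * z.2.2 + z.2.1 * boxZ4 z := rfl
  obtain ⟨h₁, h₂, h₃, -⟩ := hz
  have h₁₃ : 0 < r * z.1 * z.2.2 := by positivity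
  have h₂₄ : 0 < z.2.1 * boxZ4 z := by positivity
  have hle : z.1 * z.2.2 * boxF r z ^ (-1 : ℝ) ≤ r⁻¹ := by
    rw [Real.rpow_neg_one, ← div_eq_mul_inv, div_le_iff₀ hF, ← div_eq_inv_mul, le_div_iff₀ hr]
    linarith
  have hsq : r * (z.1 * z.2.1 * z.2.2 * boxZ4 z) ≤ boxF r z ^ (2 : ℝ) := by
    rw [Real.rpow_two, hF']
    nlinarith
  calc z.1 * z.2.2 * boxF r z ^ (-(1 + 2 * p))
      = z.1 * z.2.2 * boxF r z ^ (-1 : ℝ) * (boxF r z ^ (2 : ℝ)) ^ (-p) := by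
        rw [← Real.rpow_mul hF.le, mul_assoc _ (boxF r z ^ (-1 : ℝ)), ← Real.rpow_add hF]
        ring_nf
    _ ≤ r⁻¹ * (r * (z.1 * z.2.1 * z.2.2 * boxZ4 z)) ^ (-p) := by
        exact mul_le_mul hle (Real.rpow_le_rpow_of_nonpos (by positivity) hsq (by linarith))
          (by positivity) (by positivity)
    _ = r⁻¹ * r ^ (-p) * (z.1 * z.2.1 * z.2.2 * boxZ4 z) ^ (-p) := by
        rw [Real.mul_rpow hr.le (by positivity), mul_assoc r⁻¹]

/-- Reduction identity `r I(3,1,3,1;2ε) = I(2,1,2,1;2ε) − I(2,2,2,2;2ε)`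
for the one-loop massless box, in Feynman parameter space. -/
theorem box_reduction_3131 (r ε : ℝ) (hr : 0 < r) (hε : ε ∈ Set.Ioo (-1 : ℝ) 0) :
    IntegrableOn (fun z => z.1 ^ 2 * z.2.2 ^ 2 * boxF r z ^ (-(4 + ε))) boxDelta volume ∧
    IntegrableOn (fun z => z.1 * z.2.2 * boxF r z ^ (-(3 + ε))) boxDelta volume ∧
    IntegrableOn (fun z => z.1 * z.2.1 * z.2.2 * boxZ4 z * boxF r z ^ (-(4 + ε))) boxDelta volume ∧
    r * ∫ z in boxDelta, z.1 ^ 2 * z.2.2 ^ 2 * boxF r z ^ (-(4 + ε)) =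
      (∫ z in boxDelta, z.1 * z.2.2 * boxF r z ^ (-(3 + ε)))
        - ∫ z in boxDelta, z.1 * z.2.1 * z.2.2 * boxZ4 z * boxF r z ^ (-(4 + ε)) := by
  obtain ⟨hε₁, hε₀⟩ := hε
  have hint : IntegrableOn (fun z => z.1 * z.2.2 * boxF r z ^ (-(3 + ε))) boxDelta volume := by
    refine ((integrableOn_dirichlet (s := 1 + ε / 2) (by linarith) (by linarith)).const_mul
      (r⁻¹ * r ^ (-(1 + ε / 2)))).mono'
      (Measurable.mul (by fun_prop) ((measurable_boxF r).pow_const _)).aestronglyMeasurable ?_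
    filter_upwards [ae_restrict_mem measurableSet_boxDelta] with z hz
    have hF := boxF_pos hr hz
    have h₁ := hz.1
    have h₃ := hz.2.2.1
    rw [Real.norm_of_nonneg (by positivity), show 3 + ε = 1 + 2 * (1 + ε / 2) by ring]
    exact mul_rpow_boxF_le hr (by linarith) hz
  have hpow {z : ℝ × ℝ × ℝ} (hz : z ∈ boxDelta) :
      boxF r z ^ (-(3 + ε)) =
        (r * z.1 * z.2.2 + z.2.1 * boxZ4 z) * boxF r z ^ (-(4 + ε)) := by
    rw [show -(3 + ε) = 1 + -(4 + ε) by ring, Real.rpow_add (boxF_pos hr hz), Real.rpow_one]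
    rfl
  have hmix : IntegrableOn
      (fun z => z.1 * z.2.1 * z.2.2 * boxZ4 z * boxF r z ^ (-(4 + ε))) boxDelta volume := by
    refine hint.mono'
      (Measurable.mul (by fun_prop) ((measurable_boxF r).pow_const _)).aestronglyMeasurable ?_
    filter_upwards [ae_restrict_mem measurableSet_boxDelta] with z hz
    have hF := boxF_pos hr hz
    have h₄ := boxZ4_pos hz
    have hz' := hpow hz
    obtain ⟨h₁, h₂, h₃, -⟩ := hz
    rw [Real.norm_of_nonneg (by positivity), hz']
    have : 0 ≤ r * z.1 ^ 2 * z.2.2 ^ 2 * boxF r z ^ (-(4 + ε)) := by positivity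
    linarith
  have heq : Set.EqOn
      (fun z => z.1 * z.2.2 * boxF r z ^ (-(3 + ε)) -
        z.1 * z.2.1 * z.2.2 * boxZ4 z * boxF r z ^ (-(4 + ε)))
      (fun z => r * (z.1 ^ 2 * z.2.2 ^ 2 * boxF r z ^ (-(4 + ε)))) boxDelta := by
    intro z hz
    dsimp only
    rw [hpow hz]
    ring
  refine ⟨?_, hint, hmix, ?_⟩
  · have h : IntegrableOn (fun z => r * (z.1 ^ 2 * z.2.2 ^ 2 * boxF r z ^ (-(4 + ε))))
        boxDelta volume := (hint.sub hmix).congr_fun heq measurableSet_boxDelta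
    exact (integrable_const_mul_iff hr.ne'.isUnit _).1 h
  · rw [← integral_sub hint hmix, ← integral_const_mul]
    exact (setIntegral_congr_fun measurableSet_boxDelta heq).symm
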